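/- arXiv:1709.00335 — 2 statements merged into one kernel-verified Lean document; each statement's English description precedes it below -/
import Mathlib

section
/- Let a, b, c be complex numbers with Re(b) > 2, such that neither c nor 2b − c is a negative integer, and such that none of (1+c)/2, (2+c)/2, b + (1−c)/2, b + (2−c)/2 is a nonpositive integer. Define β(a,b,c) = c(c−b)(1+b−2bc+c²) + a(b−3bc+b²+2c²) + a²(1−b+3bc−b²−2c²) − 2a³ + a⁴ and γ(a,b,c) = (c−b)(c−2b)(1+b−2bc+c²) + a(b−5bc+3b²+2c²) + a²(1−b+5bc−3b²−2c²) − 2a³ + a⁴. Then Σ_{k=0}^{∞} k² · (a)_k (1−a)_k (1+b)_k / (k! (1+c)_k (1+2b−c)_k) = (β(a,b,c)/(b(b−1)(b−2))) · Γ((1+c)/2)Γ((2+c)/2)Γ(b+(1−c)/2)Γ(b+(2−c)/2) / (Γ((1+a+c)/2)Γ((2−a+c)/2)Γ(b+(a−c)/2)Γ(b+(1−a−c)/2)) + (γ(a,b,c)/(b(b−1)(b−2))) · Γ((1+c)/2)Γ((2+c)/2)Γ(b+(1−c)/2)Γ(b+(2−c)/2) / (Γ((a+c)/2)Γ((1−a+c)/2)Γ(b+(1+a−c)/2)Γ(b+(2−a−c)/2)).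 -/
open Finset Complex

/-- Shifted factorial (Pochhammer symbol) `(x)_k = x(x+1)⋯(x+k-1)`. -/
noncomputable def poch (x : ℂ) (k : ℕ) : ℂ := ∏ j ∈ Finset.range k, (x + j)

/-- `β(a,b,c)` from Lemma 2.7 of the paper. -/
noncomputable def betaCoeff (a b c : ℂ) : ℂ :=
  c * (c - b) * (1 + b - 2 * b * c + c ^ 2) + a * (b - 3 * b * c + b ^ 2 + 2 * c ^ 2)
    + a ^ 2 * (1 - b + 3 * b * c - b ^ 2 - 2 * c ^ 2) - 2 * a ^ 3 + a ^ 4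

/-- `γ(a,b,c)` from Lemma 2.7 of the paper. -/
noncomputable def gammaCoeff (a b c : ℂ) : ℂ :=
  (c - b) * (c - 2 * b) * (1 + b - 2 * b * c + c ^ 2) + a * (b - 5 * b * c + 3 * b ^ 2 + 2 * c ^ 2)
    + a ^ 2 * (1 - b + 5 * b * c - 3 * b ^ 2 - 2 * c ^ 2) - 2 * a ^ 3 + a ^ 4

open Filter Topology Asymptotics

lemma poch_succ (x : ℂ) (k : ℕ) : poch x (k + 1) = poch x k * (x + k) :=
  Finset.prod_range_succ _ _

lemma poch_succ' (x : ℂ) (k : ℕ) : poch x (k + 1) = x * poch (1 + x) k := by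
  rw [poch, Finset.prod_range_succ', mul_comm]
  simp only [poch, Nat.cast_zero, add_zero]
  congr 1
  refine Finset.prod_congr rfl fun j _ => ?_
  push_cast
  ring

lemma poch_ne_zero {x : ℂ} (hx : ∀ j : ℕ, x + j ≠ 0) (k : ℕ) : poch x k ≠ 0 :=
  Finset.prod_ne_zero_iff.mpr fun j _ => hx j

lemma tendsto_poch_div (x : ℂ) :
    Tendsto (fun n : ℕ => poch x (n + 1) / ((n : ℂ) ^ x * (n.factorial : ℂ))) atTop
      (𝓝 (Complex.Gamma x)⁻¹) := by
  by_cases hx : Complex.Gamma x = 0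
  · obtain ⟨m, hm⟩ := (Complex.Gamma_eq_zero_iff x).mp hx
    rw [hx, inv_zero]
    refine tendsto_const_nhds.congr' ?_
    filter_upwards [eventually_ge_atTop m] with n hn
    have : poch x (n + 1) = 0 :=
      Finset.prod_eq_zero (i := m) (Finset.mem_range.mpr (by omega)) (by simp [hm])
    rw [this, zero_div]
  · refine ((Complex.GammaSeq_tendsto_Gamma x).inv₀ hx).congr fun n => ?_
    rw [Complex.GammaSeq, inv_div, poch]

/-- The general term of `₃F₂(a, 1 - a, b; 1 + c, 1 + d; 1)`. -/
noncomputable def whippleTerm (a b c d : ℂ) (k : ℕ) : ℂ :=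
  poch a k * poch (1 - a) k * poch b k / ((k.factorial : ℂ) * poch (1 + c) k * poch (1 + d) k)

lemma whippleTerm_swap (a b c d : ℂ) : whippleTerm a b c d = whippleTerm a b d c := by
  funext k
  rw [whippleTerm, whippleTerm, mul_right_comm (k.factorial : ℂ)]

lemma whippleTerm_zero (a b c d : ℂ) : whippleTerm a b c d 0 = 1 := by
  simp [whippleTerm, poch]

lemma whippleTerm_succ {a b c d : ℂ} (hc : ∀ j : ℕ, 1 + c + j ≠ 0) (hd : ∀ j : ℕ, 1 + d + j ≠ 0)
    (k : ℕ) :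
    ((k : ℂ) + 1) * (1 + c + k) * (1 + d + k) * whippleTerm a b c d (k + 1)
      = (a + k) * (1 - a + k) * (b + k) * whippleTerm a b c d k := by
  have h1 := poch_ne_zero hc k
  have h2 := poch_ne_zero hd k
  have h3 := hc k
  have h4 := hd k
  have h5 : (k.factorial : ℂ) ≠ 0 := by exact_mod_cast k.factorial_ne_zero
  have h6 : (k : ℂ) + 1 ≠ 0 := by exact_mod_cast k.succ_ne_zero
  simp only [whippleTerm, poch_succ, Nat.factorial_succ]
  push_cast
  field_simp

lemma factorial_eq_poch (k : ℕ) : (k.factorial : ℂ) = poch 1 k := by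
  induction k with
  | zero => simp [poch]
  | succ k ih => rw [poch_succ, ← ih, Nat.factorial_succ]; push_cast; ring

lemma whippleTerm_isBigO {a b c d : ℂ} (hbcd : 2 * b = c + d)
    (hc : ∀ j : ℕ, 1 + c + j ≠ 0) (hd : ∀ j : ℕ, 1 + d + j ≠ 0) :
    (fun n : ℕ => whippleTerm a b c d (n + 1)) =O[atTop]
      fun n : ℕ => (n : ℝ) ^ (-(2 + b.re)) := by
  have hG : ∀ x : ℂ, (∀ j : ℕ, x + j ≠ 0) → (Complex.Gamma x)⁻¹ ≠ 0 := fun x hx =>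
    inv_ne_zero (Complex.Gamma_ne_zero fun m h => hx m (by rw [h]; ring))
  have h1 : ∀ j : ℕ, (1 : ℂ) + j ≠ 0 := fun j => by
    rw [add_comm]; exact_mod_cast j.succ_ne_zero
  have key := (((tendsto_poch_div a).mul (tendsto_poch_div (1 - a))).mul (tendsto_poch_div b)).div
    (((tendsto_poch_div 1).mul (tendsto_poch_div (1 + c))).mul (tendsto_poch_div (1 + d)))
    (mul_ne_zero (mul_ne_zero (hG 1 h1) (hG _ hc)) (hG _ hd))
  have hO := key.isBigO_one ℝ
  have hmul := hO.mul (isBigO_refl (fun n : ℕ => (n : ℂ) ^ (-(2 + b))) atTop).norm_right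
  refine (hmul.congr' ?_ ?_)
  · filter_upwards [eventually_ne_atTop 0] with n hn
    have hn' : (n : ℂ) ≠ 0 := by exact_mod_cast hn
    have hp : ∀ x : ℂ, (n : ℂ) ^ x ≠ 0 := fun x => by simp [Complex.cpow_eq_zero_iff, hn']
    have hf : (n.factorial : ℂ) ≠ 0 := by exact_mod_cast n.factorial_ne_zero
    have e : (n : ℂ) ^ a * (n : ℂ) ^ (1 - a) * (n : ℂ) ^ b
        = (n : ℂ) ^ (-(2 + b)) * ((n : ℂ) ^ (1 : ℂ) * (n : ℂ) ^ (1 + c) * (n : ℂ) ^ (1 + d)) := by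
      simp only [← Complex.cpow_add _ _ hn']
      congr 1
      linear_combination hbcd
    have hP1 := poch_ne_zero h1 (n + 1)
    have hP2 := poch_ne_zero hc (n + 1)
    have hP3 := poch_ne_zero hd (n + 1)
    have q1 := hp a
    have q2 := hp (1 - a)
    have q3 := hp b
    have q4 := hp 1
    have q5 := hp (1 + c)
    have q6 := hp (1 + d)
    simp only [whippleTerm, factorial_eq_poch (n + 1), Pi.div_apply]
    generalize (n : ℂ) ^ a = x1 at e q1 ⊢
    generalize (n : ℂ) ^ (1 - a) = x2 at e q2 ⊢
    generalize (n : ℂ) ^ b = x3 at e q3 ⊢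
    generalize (n : ℂ) ^ (1 : ℂ) = x4 at e q4 ⊢
    generalize (n : ℂ) ^ (1 + c) = x5 at e q5 ⊢
    generalize (n : ℂ) ^ (1 + d) = x6 at e q6 ⊢
    generalize (n : ℂ) ^ (-(2 + b)) = x7 at e ⊢
    field_simp
    linear_combination (-1 : ℂ) * poch a (n + 1) * poch (1 - a) (n + 1) * poch b (n + 1) * e
  · filter_upwards [eventually_gt_atTop 0] with n hn
    rw [one_mul, Complex.norm_natCast_cpow_of_pos hn]
    simp

lemma whippleTerm_pow_isBigO {a b c d : ℂ} (hbcd : 2 * b = c + d)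
    (hc : ∀ j : ℕ, 1 + c + j ≠ 0) (hd : ∀ j : ℕ, 1 + d + j ≠ 0) (j : ℕ) :
    (fun n : ℕ => ((n + 1 : ℕ) : ℂ) ^ j * whippleTerm a b c d (n + 1)) =O[atTop]
      fun n : ℕ => (n : ℝ) ^ ((j : ℝ) - (2 + b.re)) := by
  have h : (fun n : ℕ => ((n + 1 : ℕ) : ℂ)) =O[atTop] fun n : ℕ => (n : ℝ) := by
    refine IsBigO.of_bound 2 ?_
    filter_upwards [eventually_ge_atTop 1] with n hn
    rw [Complex.norm_natCast, Real.norm_natCast]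
    exact_mod_cast (by omega : n + 1 ≤ 2 * n)
  refine ((h.pow j).mul (whippleTerm_isBigO (a := a) hbcd hc hd)).congr' EventuallyEq.rfl ?_
  filter_upwards [eventually_gt_atTop 0] with n hn
  have hn' : (0 : ℝ) < n := by exact_mod_cast hn
  rw [sub_eq_add_neg, Real.rpow_add hn', Real.rpow_natCast]

lemma summable_pow_mul_whippleTerm {a b c d : ℂ} (hbcd : 2 * b = c + d)
    (hc : ∀ j : ℕ, 1 + c + j ≠ 0) (hd : ∀ j : ℕ, 1 + d + j ≠ 0) {j : ℕ} (hj : j < 1 + b.re) :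
    Summable fun k : ℕ => (k : ℂ) ^ j * whippleTerm a b c d k := by
  rw [← summable_nat_add_iff 1]
  refine summable_of_isBigO_nat (Real.summable_nat_rpow.mpr ?_)
    (whippleTerm_pow_isBigO hbcd hc hd j)
  linarith

lemma tendsto_pow_mul_whippleTerm {a b c d : ℂ} (hbcd : 2 * b = c + d)
    (hc : ∀ j : ℕ, 1 + c + j ≠ 0) (hd : ∀ j : ℕ, 1 + d + j ≠ 0) {j : ℕ} (hj : j < 2 + b.re) :
    Tendsto (fun k : ℕ => (k : ℂ) ^ j * whippleTerm a b c d k) atTop (𝓝 0) := by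
  rw [← tendsto_add_atTop_iff_nat 1]
  refine (whippleTerm_pow_isBigO hbcd hc hd j).trans_tendsto ?_
  have := (tendsto_rpow_neg_atTop (y := 2 + b.re - j) (by linarith)).comp
    (tendsto_natCast_atTop_atTop (R := ℝ))
  simpa [Function.comp_def] using this

lemma tsum_sub_eq_zero {f : ℕ → ℂ} (h0 : f 0 = 0) (hf : Tendsto f atTop (𝓝 0))
    (hs : Summable fun k => f (k + 1) - f k) : ∑' k, (f (k + 1) - f k) = 0 := by
  refine tendsto_nhds_unique hs.hasSum.tendsto_sum_nat ?_
  simpa only [Finset.sum_range_sub, h0, sub_zero] using hf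

lemma summable_add_mul_whippleTerm {a b c d : ℂ} (hbcd : 2 * b = c + d) (hb : 0 < b.re)
    (hc : ∀ j : ℕ, 1 + c + j ≠ 0) (hd : ∀ j : ℕ, 1 + d + j ≠ 0) (x : ℂ) :
    Summable fun k : ℕ => (x + k) * whippleTerm a b c d k := by
  have h0 := summable_pow_mul_whippleTerm (a := a) hbcd hc hd (j := 0) (by push_cast; linarith)
  have h1 := summable_pow_mul_whippleTerm (a := a) hbcd hc hd (j := 1) (by push_cast; linarith)
  exact ((h0.mul_left x).add h1).congr fun k => by ring

/-- The series `∑ (c + k) (a)ₖ (1-a)ₖ (b)ₖ / (k! (1+c)ₖ (1+d)ₖ)`. -/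
noncomputable def whippleSum (a b c d : ℂ) : ℂ := ∑' k : ℕ, (c + k) * whippleTerm a b c d k

lemma add_one_add_natCast_ne_zero {c : ℂ} (hc : ∀ j : ℕ, 1 + c + j ≠ 0) (j : ℕ) :
    1 + (c + 1) + j ≠ 0 := by
  have := hc (j + 1)
  rw [Nat.cast_add, Nat.cast_one] at this
  intro h
  exact this (by rw [← h]; ring)

lemma whippleSum_shift {a b c d : ℂ} (hbcd : 2 * b = c + d) (hb : 0 < b.re)
    (hc : ∀ j : ℕ, 1 + c + j ≠ 0) (hd : ∀ j : ℕ, 1 + d + j ≠ 0) :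
    (d + a) * (d + 1 - a) * whippleSum a (b + 1) (c + 1) (d + 1)
      = (1 + c) * (1 + d) * whippleSum a b d c := by
  have hb0 : b ≠ 0 := fun h => by simp [h] at hb
  have hbcd' : 2 * (b + 1) = (c + 1) + (d + 1) := by linear_combination hbcd
  have s1 := summable_add_mul_whippleTerm (a := a) hbcd' (by simp; linarith)
    (add_one_add_natCast_ne_zero hc) (add_one_add_natCast_ne_zero hd) (c + 1)
  have s2 := summable_add_mul_whippleTerm (a := a) hbcd hb hc hd d
  have hterm : ∀ k : ℕ, (d + a) * (d + 1 - a) * b *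
        ((c + 1 + k) * whippleTerm a (b + 1) (c + 1) (d + 1) k)
      - (1 + c) * (1 + d) * b * ((d + k) * whippleTerm a b c d k)
      = (1 + c) * (1 + d) * ((((k + 1 : ℕ) : ℂ) * (c + (k + 1 : ℕ)) * whippleTerm a b c d (k + 1))
          - ((k : ℂ) * (c + k) * whippleTerm a b c d k)) := by
    intro k
    have hs := whippleTerm_succ (a := a) (b := b) hc hd k
    have pb := (poch_succ' b k).symm.trans (poch_succ b k)
    have pc := (poch_succ' (1 + c) k).symm.trans (poch_succ (1 + c) k)
    have pd := (poch_succ' (1 + d) k).symm.trans (poch_succ (1 + d) k)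
    have d0 := hd k
    have n1 := poch_ne_zero hc k
    have n2 := poch_ne_zero hd k
    have n3 := poch_ne_zero (add_one_add_natCast_ne_zero hc) k
    have n4 := poch_ne_zero (add_one_add_natCast_ne_zero hd) k
    have hf : (k.factorial : ℂ) ≠ 0 := by exact_mod_cast k.factorial_ne_zero
    have hT : (1 + d + k) * b * ((c + 1 + k) * whippleTerm a (b + 1) (c + 1) (d + 1) k)
        = (1 + c) * (1 + d) * (b + k) * whippleTerm a b c d k := by
      rw [add_comm b 1] at *
      rw [show 1 + (1 + c) = 1 + (c + 1) by ring] at pc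
      rw [show 1 + (1 + d) = 1 + (d + 1) by ring] at pd
      simp only [whippleTerm]
      rw [mul_div_assoc', mul_div_assoc', mul_div_assoc', div_eq_div_iff
        (mul_ne_zero (mul_ne_zero hf n3) n4) (mul_ne_zero (mul_ne_zero hf n1) n2)]
      linear_combination
        (1 + d + k) * (c + 1 + k) * poch a k * poch (1 - a) k * k.factorial * poch (1 + c) k
            * poch (1 + d) k * pb
          - (b + k) * poch a k * poch (1 - a) k * poch b k * k.factorial *
            (poch (1 + d) k * (1 + d + k) * pc + (1 + c) * poch (1 + (c + 1)) k * pd)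
    apply mul_left_cancel₀ d0
    push_cast
    linear_combination (d + a) * (d + 1 - a) * hT - (1 + c) * (1 + d) * hs
      - (1 + c) * (1 + d) * (1 + d + k) * k * whippleTerm a b c d k * hbcd
  have hz : ∑' k : ℕ, ((((k + 1 : ℕ) : ℂ) * (c + (k + 1 : ℕ)) * whippleTerm a b c d (k + 1))
          - ((k : ℂ) * (c + k) * whippleTerm a b c d k)) = 0 := by
    refine tsum_sub_eq_zero (f := fun k : ℕ => (k : ℂ) * (c + k) * whippleTerm a b c d k)
      (by simp) ?_ ?_
    · have t1 := tendsto_pow_mul_whippleTerm (a := a) hbcd hc hd (j := 1) (by push_cast; linarith)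
      have t2 := tendsto_pow_mul_whippleTerm (a := a) hbcd hc hd (j := 2) (by push_cast; linarith)
      have := (t1.const_mul c).add t2
      simp only [mul_zero, add_zero] at this
      exact this.congr fun k => by ring
    · have hne : (1 + c) * (1 + d) ≠ 0 :=
        mul_ne_zero (by simpa using hc 0) (by simpa using hd 0)
      refine (summable_mul_left_iff hne).mp ?_
      exact ((s1.mul_left ((d + a) * (d + 1 - a) * b)).sub
        (s2.mul_left ((1 + c) * (1 + d) * b))).congr hterm
  have := (s1.mul_left ((d + a) * (d + 1 - a) * b)).tsum_sub
        (s2.mul_left ((1 + c) * (1 + d) * b))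
  rw [tsum_congr hterm, tsum_mul_left, hz, tsum_mul_left, tsum_mul_left,
    whippleTerm_swap a b c d] at this
  apply mul_left_cancel₀ hb0
  rw [whippleSum, whippleSum]
  linear_combination -this

lemma whippleSum_shift_two {a b c d : ℂ} (hbcd : 2 * b = c + d) (hb : 0 < b.re)
    (hc : ∀ j : ℕ, 1 + c + j ≠ 0) (hd : ∀ j : ℕ, 1 + d + j ≠ 0) :
    ((1 + c) / 2) * ((2 + c) / 2) * ((1 + d) / 2) * ((2 + d) / 2) * whippleSum a b c d
      = ((a + c) / 2) * ((1 - a + c) / 2) * ((1 + a + d) / 2) * ((2 - a + d) / 2)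
        * whippleSum a (b + 2) (c + 2) (d + 2) := by
  have h1 := whippleSum_shift (a := a) (by rw [hbcd, add_comm] : 2 * b = d + c) hb hd hc
  have h2 := whippleSum_shift (a := a) (by linear_combination hbcd : 2 * (b + 1) = c + 1 + (d + 1))
    (by simp; linarith) (add_one_add_natCast_ne_zero hc) (add_one_add_natCast_ne_zero hd)
  simp only [add_assoc, one_add_one_eq_two] at h2
  linear_combination (-1 / 16 : ℂ) * (2 + c) * (2 + d) * h1
    - (1 / 16 : ℂ) * (c + a) * (c + 1 - a) * h2

lemma whippleSum_shift_two_mul {a b c d : ℂ} (hbcd : 2 * b = c + d) (hb : 0 < b.re)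
    (hc : ∀ j : ℕ, 1 + c + j ≠ 0) (hd : ∀ j : ℕ, 1 + d + j ≠ 0) (m : ℕ) :
    poch ((1 + c) / 2) m * poch ((2 + c) / 2) m * poch ((1 + d) / 2) m * poch ((2 + d) / 2) m
        * whippleSum a b c d
      = poch ((a + c) / 2) m * poch ((1 - a + c) / 2) m * poch ((1 + a + d) / 2) m
        * poch ((2 - a + d) / 2) m
        * whippleSum a (b + (2 * m : ℕ)) (c + (2 * m : ℕ)) (d + (2 * m : ℕ)) := by
  induction m with
  | zero => simp [poch]
  | succ m ih =>
    have hsh : ∀ x : ℂ, (∀ j : ℕ, 1 + x + j ≠ 0) →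
        ∀ j : ℕ, 1 + (x + (2 * m : ℕ)) + j ≠ 0 := fun x hx j h =>
      hx (2 * m + j) (by rw [← h]; push_cast; ring)
    have h := whippleSum_shift_two (a := a) (b := b + (2 * m : ℕ)) (c := c + (2 * m : ℕ))
      (d := d + (2 * m : ℕ)) (by linear_combination hbcd)
      (by rw [Complex.add_re, Complex.natCast_re]; positivity) (hsh c hc) (hsh d hd)
    have e : ∀ x : ℂ, x + (2 * (m + 1) : ℕ) = x + (2 * m : ℕ) + 2 := fun x => by
      push_cast; ring
    simp only [poch_succ, e]
    push_cast at h ih ⊢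
    linear_combination ((1 + c) / 2 + m) * ((2 + c) / 2 + m) * ((1 + d) / 2 + m)
        * ((2 + d) / 2 + m) * ih
      + poch ((a + c) / 2) m * poch ((1 - a + c) / 2) m * poch ((1 + a + d) / 2) m
        * poch ((2 - a + d) / 2) m * h

lemma norm_le_of_ratio {u : ℕ → ℂ}
    (hu : ∀ k : ℕ, ‖u (k + 1)‖ * ((k : ℝ) + 2) ^ 2 ≤ ‖u k‖ * ((k : ℝ) + 1) ^ 2) (k : ℕ) :
    ‖u (k + 1)‖ ≤ 4 * ‖u 1‖ * (1 / ((k : ℝ) + 2) ^ 2) := by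
  have h : ‖u (k + 1)‖ * ((k : ℝ) + 2) ^ 2 ≤ 4 * ‖u 1‖ := by
    induction k with
    | zero => norm_num; linarith
    | succ k ih =>
      have := hu (k + 1)
      push_cast at this ⊢
      calc _ ≤ _ := this
        _ = ‖u (k + 1)‖ * ((k : ℝ) + 2) ^ 2 := by ring
        _ ≤ _ := ih
  rw [mul_one_div, le_div_iff₀ (by positivity)]
  exact h

lemma exists_ratio_bound (a b c d : ℂ) : ∃ N : ℕ, ∀ n ≥ N, ∀ k : ℕ,
    ‖(a + k) * (1 - a + k) * (b + n + k)‖ * ((k : ℝ) + 2) ^ 2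
      ≤ ‖(1 + d + n + k) * (c + n + k)‖ * ((k : ℝ) + 1) ^ 3 := by
  set A := 1 + ‖a‖ with hA
  set M := 4 * (A + 2) ^ 2 with hM
  set F := ‖b‖ + ‖c‖ + ‖1 + d‖ with hF
  obtain ⟨N, hN⟩ := exists_nat_ge (F + M)
  refine ⟨N, fun n hn k => ?_⟩
  have hn' : F + M ≤ n := hN.trans (by exact_mod_cast hn)
  have hk : (0 : ℝ) ≤ k := k.cast_nonneg
  have hA1 : 1 ≤ A := by rw [hA]; linarith [norm_nonneg a]
  have hM0 : 0 ≤ M := by positivity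
  set x : ℝ := (n : ℝ) + k with hx
  have hxn : ‖((n : ℂ) + k)‖ = x := by
    rw [← Nat.cast_add, Complex.norm_natCast, hx]; push_cast; rfl
  have e1 : ‖a + k‖ ≤ k + A := by
    refine (norm_add_le _ _).trans ?_
    rw [Complex.norm_natCast, hA]; linarith
  have e2 : ‖1 - a + k‖ ≤ k + A := by
    refine (norm_add_le _ _).trans ?_
    have := norm_sub_le (1 : ℂ) a
    rw [norm_one] at this
    rw [Complex.norm_natCast, hA]; linarith
  have e3 : ‖b + n + k‖ ≤ x + ‖b‖ := by
    rw [add_assoc]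
    refine (norm_add_le _ _).trans ?_
    rw [hxn]; linarith
  have e4 : ∀ y : ℂ, x - ‖y‖ ≤ ‖y + n + k‖ := fun y => by
    have := norm_sub_le (y + n + k) y
    rw [show y + n + k - y = (n : ℂ) + k by ring, hxn] at this
    linarith
  have hb := norm_nonneg b
  have hc := norm_nonneg c
  have hd := norm_nonneg (1 + d)
  have e5 : (x + ‖b‖) * (x - F) ≤ ‖(1 + d + n + k) * (c + n + k)‖ := by
    rw [norm_mul]
    calc (x + ‖b‖) * (x - F) ≤ (x - ‖1 + d‖) * (x - ‖c‖) := by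
          rw [hF]; nlinarith [mul_nonneg hb hb, mul_nonneg hb hc, mul_nonneg hb hd,
            mul_nonneg hc hd]
      _ ≤ _ := mul_le_mul (e4 _) (e4 _) (by linarith) (norm_nonneg _)
  have e6 : ((k : ℝ) + A) ^ 2 * (k + 2) ^ 2 ≤ (k + M) * (k + 1) ^ 3 := by
    have : (k + M) * (k + 1) ^ 3 - ((k : ℝ) + A) ^ 2 * (k + 2) ^ 2
        = (4 * A ^ 2 + 14 * A + 15) * k ^ 3 + (11 * A ^ 2 + 40 * A + 47) * k ^ 2
          + (8 * A ^ 2 + 40 * A + 49) * k + (16 * A + 16) := by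
      rw [hM]; ring
    have : 0 ≤ (4 * A ^ 2 + 14 * A + 15) * (k : ℝ) ^ 3 + (11 * A ^ 2 + 40 * A + 47) * k ^ 2
          + (8 * A ^ 2 + 40 * A + 49) * k + (16 * A + 16) := by positivity
    linarith
  have e7 : (k : ℝ) + M ≤ x - F := by rw [hx]; linarith
  have hx0 : 0 ≤ x + ‖b‖ := by positivity
  calc ‖(a + k) * (1 - a + k) * (b + n + k)‖ * ((k : ℝ) + 2) ^ 2
      ≤ ((k + A) * (k + A) * (x + ‖b‖)) * ((k : ℝ) + 2) ^ 2 := by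
        rw [norm_mul, norm_mul]; gcongr
    _ = (x + ‖b‖) * (((k : ℝ) + A) ^ 2 * (k + 2) ^ 2) := by ring
    _ ≤ (x + ‖b‖) * ((k + M) * (k + 1) ^ 3) := by gcongr
    _ ≤ (x + ‖b‖) * ((x - F) * (k + 1) ^ 3) := by gcongr
    _ = ((x + ‖b‖) * (x - F)) * (k + 1) ^ 3 := by ring
    _ ≤ _ := by gcongr

lemma eventually_add_natCast_add_natCast_ne_zero (x : ℂ) :
    ∀ᶠ n : ℕ in atTop, ∀ j : ℕ, x + n + j ≠ 0 := by
  obtain ⟨N, hN⟩ := exists_nat_gt ‖x‖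
  filter_upwards [eventually_ge_atTop N] with n hn j h
  have : ‖x‖ = n + j := by
    rw [show x = -((n + j : ℕ) : ℂ) by push_cast; linear_combination h, norm_neg,
      Complex.norm_natCast]
    push_cast; rfl
  have hn' : (N : ℝ) ≤ n := by exact_mod_cast hn
  have : (0 : ℝ) ≤ j := j.cast_nonneg
  linarith

lemma tendsto_add_natCast_div_add_natCast (x y : ℂ) :
    Tendsto (fun n : ℕ => (x + n) / (y + n)) atTop (𝓝 1) := by
  have h : ∀ z : ℂ, Tendsto (fun n : ℕ => z / n + 1) atTop (𝓝 1) := fun z => by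
    simpa using (tendsto_const_div_atTop_nhds_zero_nat z).add_const 1
  have := (h x).div (h y) one_ne_zero
  rw [div_one] at this
  refine this.congr' ?_
  filter_upwards [eventually_ne_atTop 0] with n hn
  have hn' : (n : ℂ) ≠ 0 := by exact_mod_cast hn
  simp only [Pi.div_apply]
  rw [div_add_one hn', div_add_one hn', div_div_div_cancel_right₀ hn']

lemma whippleSum_sub_isBigO_one (a b c d : ℂ) :
    (fun n : ℕ => whippleSum a (b + n) (c + n) (d + n) - (c + n)) =O[atTop]
      fun _ => (1 : ℝ) := by
  obtain ⟨N, hN⟩ := exists_ratio_bound a b c d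
  set Z := ∑' k : ℕ, 1 / ((k : ℝ) + 2) ^ 2
  have hZ : Summable fun k : ℕ => 1 / ((k : ℝ) + 2) ^ 2 := by
    have := (summable_nat_add_iff 2).mpr (Real.summable_one_div_nat_pow.mpr one_lt_two)
    exact this.congr fun k => by push_cast; rfl
  have hbd := ((tendsto_add_natCast_div_add_natCast b (1 + d)).const_mul (a * (1 - a))).isBigO_one ℝ
  have hbd' := hbd.norm_left.const_mul_left (4 * Z)
  refine IsBigO.trans (IsBigO.of_bound 1 ?_) hbd'
  filter_upwards [eventually_ge_atTop N, eventually_add_natCast_add_natCast_ne_zero c,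
    eventually_add_natCast_add_natCast_ne_zero (1 + c),
    eventually_add_natCast_add_natCast_ne_zero (1 + d)] with n hn hc0 hc1 hd1
  simp only [add_assoc (1 : ℂ)] at hc1 hd1
  simp only [← add_assoc (1 : ℂ) (_ + _)] at hc1 hd1
  set u : ℕ → ℂ := fun k => (c + n + k) * whippleTerm a (b + n) (c + n) (d + n) k with hu
  have hrec : ∀ k : ℕ, ((k : ℂ) + 1) * ((1 + d + n + k) * (c + n + k)) * u (k + 1)
      = (a + k) * (1 - a + k) * (b + n + k) * u k := fun k => by
    have := whippleTerm_succ (a := a) (b := b + n) hc1 hd1 k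
    simp only [hu]
    push_cast
    linear_combination (c + n + k) * this
  have hD : ∀ k : ℕ, 0 < ‖(1 + d + n + k) * (c + n + k)‖ := fun k =>
    norm_pos_iff.mpr (mul_ne_zero (by simpa only [add_assoc] using hd1 k) (hc0 k))
  have hratio : ∀ k : ℕ, ‖u (k + 1)‖ * ((k : ℝ) + 2) ^ 2 ≤ ‖u k‖ * ((k : ℝ) + 1) ^ 2 := fun k => by
    have h1 := congrArg norm (hrec k)
    rw [norm_mul, norm_mul, norm_mul _ (u k),
      show ‖(k : ℂ) + 1‖ = (k : ℝ) + 1 by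
        rw [← Nat.cast_succ, Complex.norm_natCast]; push_cast; rfl] at h1
    have h2 := mul_le_mul_of_nonneg_right (hN n hn k) (norm_nonneg (u k))
    have hk : (0 : ℝ) < k + 1 := by positivity
    refine le_of_mul_le_mul_left ?_ (mul_pos hk (hD k))
    calc _ = (((k : ℝ) + 1) * ‖(1 + d + n + k) * (c + n + k)‖ * ‖u (k + 1)‖) * (k + 2) ^ 2 := by
          ring
      _ = ‖(a + k) * (1 - a + k) * (b + n + k)‖ * ((k : ℝ) + 2) ^ 2 * ‖u k‖ := by rw [h1]; ring
      _ ≤ _ := h2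
      _ = _ := by ring
  have hle := norm_le_of_ratio hratio
  have hS : Summable fun k : ℕ => u (k + 1) :=
    Summable.of_norm_bounded (hZ.mul_left (4 * ‖u 1‖)) hle
  have hu0 : u 0 = c + n := by simp [hu, whippleTerm_zero]
  have hu1 : u 1 = a * (1 - a) * ((b + n) / (1 + d + n)) := by
    have := hrec 0
    rw [hu0] at this
    have hc' := hc0 0
    have hd' := hd1 0
    simp only [Nat.cast_zero, add_zero, zero_add, one_mul, ← add_assoc] at this hc' hd'
    rw [mul_div_assoc', eq_div_iff hd']
    apply mul_left_cancel₀ hc'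
    linear_combination this
  have hsum : whippleSum a (b + n) (c + n) (d + n) - (c + n) = ∑' k, u (k + 1) := by
    rw [whippleSum, ((summable_nat_add_iff 1).mp hS).tsum_eq_zero_add, hu0]
    ring
  rw [hsum, one_mul, ← hu1]
  have hb2 : ‖∑' k, u (k + 1)‖ ≤ 4 * ‖u 1‖ * Z := by
    refine (tsum_of_norm_bounded (hZ.hasSum.mul_left (4 * ‖u 1‖)) hle)
  refine hb2.trans ((le_abs_self _).trans (le_of_eq ?_))
  rw [Real.norm_eq_abs]
  congr 1
  ring

lemma tendsto_whippleSum_div (a b c d : ℂ) :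
    Tendsto (fun n : ℕ => whippleSum a (b + n) (c + n) (d + n) / n) atTop (𝓝 1) := by
  have h1 : Tendsto (fun n : ℕ =>
      (whippleSum a (b + n) (c + n) (d + n) - (c + n)) * ((n : ℂ))⁻¹) atTop (𝓝 0) := by
    have h := (whippleSum_sub_isBigO_one a b c d).mul
      (isBigO_refl (fun n : ℕ => ((n : ℂ))⁻¹) atTop).norm_right
    refine h.trans_tendsto ?_
    simpa using tendsto_inv_atTop_nhds_zero_nat (𝕜 := ℝ)
  have h2 := h1.add (tendsto_add_natCast_div_add_natCast c 0)
  rw [zero_add] at h2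
  refine h2.congr fun n => ?_
  ring

/-- Whipple's summation theorem, in a form without poles at `c = 0`. -/
theorem whippleSum_eq {a b c d : ℂ} (hbcd : 2 * b = c + d) (hb : 0 < b.re)
    (hc : ∀ j : ℕ, 1 + c + j ≠ 0) (hd : ∀ j : ℕ, 1 + d + j ≠ 0) :
    whippleSum a b c d = 2 *
      (Complex.Gamma ((1 + c) / 2) * Complex.Gamma ((2 + c) / 2) *
        Complex.Gamma ((1 + d) / 2) * Complex.Gamma ((2 + d) / 2)) /
      (Complex.Gamma ((a + c) / 2) * Complex.Gamma ((1 - a + c) / 2) *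
        Complex.Gamma ((1 + a + d) / 2) * Complex.Gamma ((2 - a + d) / 2)) := by
  have hG : ∀ x : ℂ, (∀ j : ℕ, 1 + x + j ≠ 0) →
      Complex.Gamma ((1 + x) / 2) ≠ 0 ∧ Complex.Gamma ((2 + x) / 2) ≠ 0 := fun x hx =>
    ⟨Complex.Gamma_ne_zero fun m h => hx (2 * m) (by push_cast; linear_combination 2 * h),
      Complex.Gamma_ne_zero fun m h => hx (2 * m + 1) (by push_cast; linear_combination 2 * h)⟩
  obtain ⟨g1, g2⟩ := hG c hc
  obtain ⟨g3, g4⟩ := hG d hd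
  have hL := ((((tendsto_poch_div ((1 + c) / 2)).mul (tendsto_poch_div ((2 + c) / 2))).mul
    (tendsto_poch_div ((1 + d) / 2))).mul (tendsto_poch_div ((2 + d) / 2))).mul_const
    (whippleSum a b c d)
  have hsub : Tendsto (fun n : ℕ => 2 * (n + 1)) atTop atTop :=
    tendsto_atTop_mono (fun n => by simp; omega) tendsto_id
  have hW := (tendsto_whippleSum_div a b c d).comp hsub
  have hR := (((((tendsto_poch_div ((a + c) / 2)).mul (tendsto_poch_div ((1 - a + c) / 2))).mul
    (tendsto_poch_div ((1 + a + d) / 2))).mul (tendsto_poch_div ((2 - a + d) / 2))).mul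
    (((tendsto_add_natCast_div_add_natCast 1 0).const_mul 2).mul hW))
  have heq := tendsto_nhds_unique (hL.congr' ?_) hR
  · rw [← mul_right_inj' (mul_ne_zero (mul_ne_zero (mul_ne_zero g1 g2) g3) g4), ← mul_assoc,
      ← mul_inv, ← mul_inv, ← mul_inv,
      mul_inv_cancel₀ (mul_ne_zero (mul_ne_zero (mul_ne_zero g1 g2) g3) g4), one_mul] at heq
    rw [heq]
    ring
  · filter_upwards [eventually_ne_atTop 0] with n hn
    have hn' : (n : ℂ) ≠ 0 := by exact_mod_cast hn
    have hn1 : (n : ℂ) + 1 ≠ 0 := by exact_mod_cast n.succ_ne_zero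
    have e : (n : ℂ) ^ ((1 + c) / 2) * (n : ℂ) ^ ((2 + c) / 2) * (n : ℂ) ^ ((1 + d) / 2)
          * (n : ℂ) ^ ((2 + d) / 2)
        = (n : ℂ) ^ ((a + c) / 2) * (n : ℂ) ^ ((1 - a + c) / 2) * (n : ℂ) ^ ((1 + a + d) / 2)
          * (n : ℂ) ^ ((2 - a + d) / 2) * n := by
      nth_rewrite 9 [← Complex.cpow_one (n : ℂ)]
      simp only [← Complex.cpow_add _ _ hn']
      congr 1
      ring
    have h := whippleSum_shift_two_mul (a := a) hbcd hb hc hd (n + 1)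
    simp only [Function.comp_apply, zero_add, div_mul_div_comm]
    have hW' : ∀ w : ℂ, 2 * ((1 + (n : ℂ)) / n) * (w / ((2 * (n + 1) : ℕ) : ℂ)) = w / n :=
      fun w => by
        push_cast
        field_simp
        ring
    rw [hW', div_mul_eq_mul_div, h, div_mul_div_comm]
    congr 1
    linear_combination (n.factorial : ℂ) ^ 4 * e

section moments

variable {a b c d : ℂ}

lemma tsum_whippleTerm_relation (hbcd : 2 * b = c + d) (hb : 1 < b.re)
    (hc : ∀ j : ℕ, 1 + c + j ≠ 0) (hd : ∀ j : ℕ, 1 + d + j ≠ 0) :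
    (1 - b) * ∑' k : ℕ, (k : ℂ) ^ 2 * whippleTerm a b c d k
      + (a * (1 - a) + b - c * d) * ∑' k : ℕ, (k : ℂ) ^ 1 * whippleTerm a b c d k
      + a * (1 - a) * b * ∑' k : ℕ, (k : ℂ) ^ 0 * whippleTerm a b c d k = 0 := by
  have s : ∀ j : ℕ, j ≤ 2 → HasSum (fun k : ℕ => (k : ℂ) ^ j * whippleTerm a b c d k)
      (∑' k : ℕ, (k : ℂ) ^ j * whippleTerm a b c d k) := fun j hj => by
    have : (j : ℝ) ≤ 2 := by exact_mod_cast hj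
    exact (summable_pow_mul_whippleTerm hbcd hc hd (by linarith)).hasSum
  have t : ∀ j : ℕ, j ≤ 3 → Tendsto (fun k : ℕ => (k : ℂ) ^ j * whippleTerm a b c d k) atTop
      (𝓝 0) := fun j hj => by
    have : (j : ℝ) ≤ 3 := by exact_mod_cast hj
    exact tendsto_pow_mul_whippleTerm hbcd hc hd (by linarith)
  have h := (((s 2 le_rfl).mul_left (1 - b)).add
    ((s 1 (by norm_num)).mul_left (a * (1 - a) + b - c * d))).add
    ((s 0 (by norm_num)).mul_left (a * (1 - a) * b))
  let f : ℕ → ℂ := fun k => k * (c + k) * (d + k) * whippleTerm a b c d k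
  have ht : Tendsto f atTop (𝓝 0) := by
    have := ((t 3 le_rfl).add ((t 2 (by norm_num)).const_mul (c + d))).add
      ((t 1 (by norm_num)).const_mul (c * d))
    simp only [mul_zero, add_zero] at this
    exact this.congr fun k => by simp only [f]; ring
  have hterm : ∀ k : ℕ, (1 - b) * ((k : ℂ) ^ 2 * whippleTerm a b c d k)
      + (a * (1 - a) + b - c * d) * ((k : ℂ) ^ 1 * whippleTerm a b c d k)
      + a * (1 - a) * b * ((k : ℂ) ^ 0 * whippleTerm a b c d k) = f (k + 1) - f k := fun k => by
    have hs := whippleTerm_succ (a := a) (b := b) hc hd k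
    simp only [f]
    push_cast
    linear_combination -hs - (k : ℂ) ^ 2 * whippleTerm a b c d k * hbcd
  rw [← h.tsum_eq, tsum_congr hterm]
  exact tsum_sub_eq_zero (by simp [f]) ht (h.summable.congr hterm)

lemma tsum_mul_whippleTerm_relation (hbcd : 2 * b = c + d) (hb : 2 < b.re)
    (hc : ∀ j : ℕ, 1 + c + j ≠ 0) (hd : ∀ j : ℕ, 1 + d + j ≠ 0) :
    (2 - b) * ∑' k : ℕ, (k : ℂ) ^ 3 * whippleTerm a b c d k
      + (a * (1 - a) + 2 * b + 1 - c * d) * ∑' k : ℕ, (k : ℂ) ^ 2 * whippleTerm a b c d k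
      + (a * (1 - a) * b + a * (1 - a) + b) * ∑' k : ℕ, (k : ℂ) ^ 1 * whippleTerm a b c d k
      + a * (1 - a) * b * ∑' k : ℕ, (k : ℂ) ^ 0 * whippleTerm a b c d k = 0 := by
  have s : ∀ j : ℕ, j ≤ 3 → HasSum (fun k : ℕ => (k : ℂ) ^ j * whippleTerm a b c d k)
      (∑' k : ℕ, (k : ℂ) ^ j * whippleTerm a b c d k) := fun j hj => by
    have : (j : ℝ) ≤ 3 := by exact_mod_cast hj
    exact (summable_pow_mul_whippleTerm hbcd hc hd (by linarith)).hasSum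
  have t : ∀ j : ℕ, j ≤ 4 → Tendsto (fun k : ℕ => (k : ℂ) ^ j * whippleTerm a b c d k) atTop
      (𝓝 0) := fun j hj => by
    have : (j : ℝ) ≤ 4 := by exact_mod_cast hj
    exact tendsto_pow_mul_whippleTerm hbcd hc hd (by linarith)
  have h := ((((s 3 le_rfl).mul_left (2 - b)).add
    ((s 2 (by norm_num)).mul_left (a * (1 - a) + 2 * b + 1 - c * d))).add
    ((s 1 (by norm_num)).mul_left (a * (1 - a) * b + a * (1 - a) + b))).add
    ((s 0 (by norm_num)).mul_left (a * (1 - a) * b))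
  let f : ℕ → ℂ := fun k => k ^ 2 * (c + k) * (d + k) * whippleTerm a b c d k
  have ht : Tendsto f atTop (𝓝 0) := by
    have := ((t 4 le_rfl).add ((t 3 (by norm_num)).const_mul (c + d))).add
      ((t 2 (by norm_num)).const_mul (c * d))
    simp only [mul_zero, add_zero] at this
    exact this.congr fun k => by simp only [f]; ring
  have hterm : ∀ k : ℕ, (2 - b) * ((k : ℂ) ^ 3 * whippleTerm a b c d k)
      + (a * (1 - a) + 2 * b + 1 - c * d) * ((k : ℂ) ^ 2 * whippleTerm a b c d k)
      + (a * (1 - a) * b + a * (1 - a) + b) * ((k : ℂ) ^ 1 * whippleTerm a b c d k)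
      + a * (1 - a) * b * ((k : ℂ) ^ 0 * whippleTerm a b c d k) = f (k + 1) - f k := fun k => by
    have hs := whippleTerm_succ (a := a) (b := b) hc hd k
    simp only [f]
    push_cast
    linear_combination -((k : ℂ) + 1) * hs - (k : ℂ) ^ 3 * whippleTerm a b c d k * hbcd
  rw [← h.tsum_eq, tsum_congr hterm]
  exact tsum_sub_eq_zero (by simp [f]) ht (h.summable.congr hterm)

lemma whippleSum_eq_tsum (hbcd : 2 * b = c + d) (hb : 0 < b.re)
    (hc : ∀ j : ℕ, 1 + c + j ≠ 0) (hd : ∀ j : ℕ, 1 + d + j ≠ 0) :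
    whippleSum a b c d = c * ∑' k : ℕ, (k : ℂ) ^ 0 * whippleTerm a b c d k
      + ∑' k : ℕ, (k : ℂ) ^ 1 * whippleTerm a b c d k := by
  have h0 := summable_pow_mul_whippleTerm (a := a) hbcd hc hd (j := 0) (by push_cast; linarith)
  have h1 := summable_pow_mul_whippleTerm (a := a) hbcd hc hd (j := 1) (by push_cast; linarith)
  rw [whippleSum, ← tsum_mul_left, ← (h0.mul_left c).tsum_add h1]
  exact tsum_congr fun k => by ring

end moments

theorem stmt9 (a b c : ℂ) (hb : 2 < b.re)
    (hc : ∀ m : ℤ, m < 0 → c ≠ (m : ℂ) ∧ 2 * b - c ≠ (m : ℂ))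
    (hΓ : ∀ m : ℤ, m ≤ 0 →
      (1 + c) / 2 ≠ (m : ℂ) ∧ (2 + c) / 2 ≠ (m : ℂ) ∧
      b + (1 - c) / 2 ≠ (m : ℂ) ∧ b + (2 - c) / 2 ≠ (m : ℂ)) :
    ∑' k : ℕ, (k : ℂ) ^ 2 * poch a k * poch (1 - a) k * poch (1 + b) k /
        ((k.factorial : ℂ) * poch (1 + c) k * poch (1 + 2 * b - c) k)
    = (betaCoeff a b c / (b * (b - 1) * (b - 2))) *
        (Complex.Gamma ((1 + c) / 2) * Complex.Gamma ((2 + c) / 2) *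
            Complex.Gamma (b + (1 - c) / 2) * Complex.Gamma (b + (2 - c) / 2)) /
        (Complex.Gamma ((1 + a + c) / 2) * Complex.Gamma ((2 - a + c) / 2) *
            Complex.Gamma (b + (a - c) / 2) * Complex.Gamma (b + (1 - a - c) / 2))
      + (gammaCoeff a b c / (b * (b - 1) * (b - 2))) *
        (Complex.Gamma ((1 + c) / 2) * Complex.Gamma ((2 + c) / 2) *
            Complex.Gamma (b + (1 - c) / 2) * Complex.Gamma (b + (2 - c) / 2)) /
        (Complex.Gamma ((a + c) / 2) * Complex.Gamma ((1 - a + c) / 2) *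
            Complex.Gamma (b + (1 + a - c) / 2) * Complex.Gamma (b + (2 - a - c) / 2)) := by
  have hc' : ∀ j : ℕ, 1 + c + j ≠ 0 := fun j h =>
    (hc (-(j + 1)) (by omega)).1 (by push_cast; linear_combination h)
  have hd' : ∀ j : ℕ, 1 + (2 * b - c) + j ≠ 0 := fun j h =>
    (hc (-(j + 1)) (by omega)).2 (by push_cast; linear_combination h)
  have hbcd : 2 * b = c + (2 * b - c) := by ring
  have hb0 : b ≠ 0 := fun h => by norm_num [h] at hb
  have hb1 : b - 1 ≠ 0 := fun h => by norm_num [sub_eq_zero.mp h] at hb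
  have hb2 : b - 2 ≠ 0 := fun h => by norm_num [sub_eq_zero.mp h] at hb
  have r1 := tsum_whippleTerm_relation (a := a) hbcd (by linarith) hc' hd'
  have r2 := tsum_mul_whippleTerm_relation (a := a) hbcd hb hc' hd'
  have w1 := whippleSum_eq (a := a) hbcd (by linarith) hc' hd'
  have w2 := whippleSum_eq (a := a) (by ring : 2 * b = (2 * b - c) + c) (by linarith) hd' hc'
  rw [whippleSum_eq_tsum hbcd (by linarith) hc' hd'] at w1
  rw [whippleSum_eq_tsum (by ring) (by linarith) hd' hc', whippleTerm_swap] at w2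
  have s2 := summable_pow_mul_whippleTerm (a := a) hbcd hc' hd' (j := 2) (by push_cast; linarith)
  have s3 := summable_pow_mul_whippleTerm (a := a) hbcd hc' hd' (j := 3) (by push_cast; linarith)
  have hS : ∑' k : ℕ, (k : ℂ) ^ 2 * poch a k * poch (1 - a) k * poch (1 + b) k /
        ((k.factorial : ℂ) * poch (1 + c) k * poch (1 + 2 * b - c) k)
      = ∑' k : ℕ, (k : ℂ) ^ 2 * whippleTerm a b c (2 * b - c) k
        + b⁻¹ * ∑' k : ℕ, (k : ℂ) ^ 3 * whippleTerm a b c (2 * b - c) k := by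
    rw [← tsum_mul_left, ← s2.tsum_add (s3.mul_left b⁻¹)]
    refine tsum_congr fun k => ?_
    have pb : poch (1 + b) k = b⁻¹ * (poch b k * (b + k)) := by
      rw [eq_inv_mul_iff_mul_eq₀ hb0, ← poch_succ', poch_succ]
    rw [whippleTerm, pb, add_sub_assoc]
    field_simp
  have e1 : (1 + (2 * b - c)) / 2 = b + (1 - c) / 2 := by ring
  have e2 : (2 + (2 * b - c)) / 2 = b + (2 - c) / 2 := by ring
  have e3 : (1 + a + (2 * b - c)) / 2 = b + (1 + a - c) / 2 := by ring
  have e4 : (2 - a + (2 * b - c)) / 2 = b + (2 - a - c) / 2 := by ring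
  have e5 : (a + (2 * b - c)) / 2 = b + (a - c) / 2 := by ring
  have e6 : (1 - a + (2 * b - c)) / 2 = b + (1 - a - c) / 2 := by ring
  rw [e1, e2, e3, e4] at w1
  rw [e1, e2, e5, e6] at w2
  rw [hS, mul_div_assoc (betaCoeff a b c / _), mul_div_assoc (gammaCoeff a b c / _)]
  rw [mul_div_assoc] at w1 w2
  rw [show Complex.Gamma ((1 + c) / 2) * Complex.Gamma ((2 + c) / 2) *
            Complex.Gamma (b + (1 - c) / 2) * Complex.Gamma (b + (2 - c) / 2) /
        (Complex.Gamma ((1 + a + c) / 2) * Complex.Gamma ((2 - a + c) / 2) *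
            Complex.Gamma (b + (a - c) / 2) * Complex.Gamma (b + (1 - a - c) / 2))
      = ((2 * b - c) * ∑' k : ℕ, (k : ℂ) ^ 0 * whippleTerm a b c (2 * b - c) k
      + ∑' k : ℕ, (k : ℂ) ^ 1 * whippleTerm a b c (2 * b - c) k) / 2 by rw [w2]; ring,
    show Complex.Gamma ((1 + c) / 2) * Complex.Gamma ((2 + c) / 2) *
            Complex.Gamma (b + (1 - c) / 2) * Complex.Gamma (b + (2 - c) / 2) /
        (Complex.Gamma ((a + c) / 2) * Complex.Gamma ((1 - a + c) / 2) *
            Complex.Gamma (b + (1 + a - c) / 2) * Complex.Gamma (b + (2 - a - c) / 2))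
      = (c * ∑' k : ℕ, (k : ℂ) ^ 0 * whippleTerm a b c (2 * b - c) k
      + ∑' k : ℕ, (k : ℂ) ^ 1 * whippleTerm a b c (2 * b - c) k) / 2 by rw [w1]; ring]
  generalize (∑' k : ℕ, (k : ℂ) ^ 0 * whippleTerm a b c (2 * b - c) k) = M0 at r1 r2 ⊢
  generalize (∑' k : ℕ, (k : ℂ) ^ 1 * whippleTerm a b c (2 * b - c) k) = M1 at r1 r2 ⊢
  generalize (∑' k : ℕ, (k : ℂ) ^ 2 * whippleTerm a b c (2 * b - c) k) = M2 at r1 r2 ⊢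
  generalize (∑' k : ℕ, (k : ℂ) ^ 3 * whippleTerm a b c (2 * b - c) k) = M3 at r1 r2 ⊢
  have hM : (b * M2 + M3) * (b - 1) * (b - 2)
      = betaCoeff a b c * (((2 * b - c) * M0 + M1) / 2)
        + gammaCoeff a b c * ((c * M0 + M1) / 2) := by
    rw [betaCoeff, gammaCoeff]
    linear_combination -(b * (b - 2) + (a * (1 - a) + 2 * b + 1 - c * (2 * b - c))) * r1
      - (b - 1) * r2
  field_simp
  linear_combination 2 * hM
end

section
/- For every integer n ≥ 2, Σ_{k=0}^{n} (−1)^k C(n,k) · k · H_{n+k}^{⟨2⟩} = ((n+1)/(n−1)) · (1/C(2n,n)) · (H_{2n} − H_{n+1}). -/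
open Finset

/-- Harmonic number `H_n = ∑_{k=1}^n 1/k`. -/
noncomputable def harm (n : ℕ) : ℝ := ∑ k ∈ Finset.range n, 1 / ((k : ℝ) + 1)

/-- Second-order harmonic number `H_n^{⟨2⟩} = ∑_{k=1}^n 1/k²`. -/
noncomputable def harm2 (n : ℕ) : ℝ := ∑ k ∈ Finset.range n, 1 / ((k : ℝ) + 1) ^ 2

lemma harm_succ (n : ℕ) : harm (n + 1) = harm n + 1 / ((n : ℝ) + 1) := by
  simp only [harm, sum_range_succ]

lemma harm2_succ (n : ℕ) : harm2 (n + 1) = harm2 n + 1 / ((n : ℝ) + 1) ^ 2 := by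
  simp only [harm2, sum_range_succ]

/-- Pascal's recurrence for alternating binomial sums of a shifted sequence. -/
lemma alternating_choose_sum_succ (f : ℕ → ℝ) (m a : ℕ) :
    ∑ j ∈ range (m + 2), ((m + 1).choose j : ℝ) * ((-1) ^ j * f (a + j))
      = ∑ j ∈ range (m + 1), (m.choose j : ℝ) * ((-1) ^ j * f (a + j))
        - ∑ j ∈ range (m + 1), (m.choose j : ℝ) * ((-1) ^ j * f (a + 1 + j)) := by
  rw [sum_choose_succ_mul (fun i _ => (-1) ^ i * f (a + i)) m, sub_eq_add_neg,
    ← sum_neg_distrib]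
  congr 1
  refine sum_congr rfl fun j _ => ?_
  rw [show a + (j + 1) = a + 1 + j by ring]
  ring

/-- The iterated differences of the second-order harmonic numbers in closed form. -/
lemma alternating_choose_sum_harm2 (m a : ℕ) :
    ∑ j ∈ range (m + 2), ((m + 1).choose j : ℝ) * ((-1) ^ j * harm2 (a + j))
      = -((m.factorial : ℝ) * a.factorial / (a + m + 1).factorial)
          * (harm (a + m + 1) - harm a) := by
  induction m generalizing a with
  | zero =>
    have ha : (a.factorial : ℝ) ≠ 0 := by positivity
    have ha1 : (a : ℝ) + 1 ≠ 0 := by positivity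
    simp [sum_range_succ, harm2_succ, harm_succ, Nat.factorial_succ]
    field_simp
  | succ m ih =>
    rw [alternating_choose_sum_succ, ih a, ih (a + 1),
      show a + 1 + m + 1 = a + m + 1 + 1 by ring, show a + (m + 1) + 1 = a + m + 1 + 1 by ring,
      harm_succ (a + m + 1), harm_succ a, Nat.factorial_succ (a + m + 1), Nat.factorial_succ a,
      Nat.factorial_succ m]
    have hf : ((a + m + 1).factorial : ℝ) ≠ 0 := by positivity
    have ha1 : (a : ℝ) + 1 ≠ 0 := by positivity
    have ham : (a : ℝ) + m + 1 + 1 ≠ 0 := by positivity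
    push_cast
    field_simp
    ring

theorem stmt14 (n : ℕ) (hn : 2 ≤ n) :
    ∑ k ∈ Finset.range (n + 1), (-1 : ℝ) ^ k * (n.choose k : ℝ) * (k : ℝ) * harm2 (n + k)
    = (((n : ℝ) + 1) / ((n : ℝ) - 1)) * (1 / ((2 * n).choose n : ℝ)) *
        (harm (2 * n) - harm (n + 1)) := by
  obtain ⟨m, rfl⟩ : ∃ m, n = m + 2 := ⟨n - 2, by omega⟩
  have absorb : ∑ k ∈ range (m + 2 + 1),
      (-1 : ℝ) ^ k * ((m + 2).choose k : ℝ) * (k : ℝ) * harm2 (m + 2 + k)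
        = -((m : ℝ) + 2) * ∑ j ∈ range (m + 2),
            ((m + 1).choose j : ℝ) * ((-1) ^ j * harm2 (m + 3 + j)) := by
    rw [sum_range_succ', mul_sum]
    simp only [Nat.cast_zero, mul_zero, zero_mul, add_zero]
    refine sum_congr rfl fun j _ => ?_
    have h : ((m : ℝ) + 2) * (m + 1).choose j = (m + 2).choose (j + 1) * ((j : ℝ) + 1) := by
      exact_mod_cast Nat.add_one_mul_choose_eq (m + 1) j
    rw [show m + 2 + (j + 1) = m + 3 + j by ring]
    push_cast
    linear_combination (-1 : ℝ) ^ j * harm2 (m + 3 + j) * h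
  have hchoose : (((2 * (m + 2)).choose (m + 2) : ℕ) : ℝ)
      = (2 * (m + 2)).factorial / ((m + 2).factorial * (m + 2).factorial) := by
    rw [Nat.cast_choose ℝ (by omega), show 2 * (m + 2) - (m + 2) = m + 2 by omega]
  rw [absorb, alternating_choose_sum_harm2, hchoose,
    show m + 3 + m + 1 = 2 * (m + 2) by ring, show m + 2 + 1 = m + 3 by ring,
    Nat.factorial_succ (m + 2), Nat.factorial_succ (m + 1), Nat.factorial_succ m]
  have hf : ((2 * (m + 2)).factorial : ℝ) ≠ 0 := by positivity
  have hm : (m : ℝ) + 1 ≠ 0 := by positivity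
  have hsub : ((m + 2 : ℕ) : ℝ) - 1 = m + 1 := by push_cast; ring
  rw [hsub]
  push_cast
  field_simp
  ring
end
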